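/- For the sequence b = (n, n−1, …, 2, 1), the ideal I_b equals the ideal of R = ℂ[x_1,…,x_n] generated by all symmetric polynomials (polynomials invariant under every permutation of x_1,…,x_n) with zero constant term; consequently R_b = R/I_b is the coinvariant algebra and has ℂ-dimension n!. -/

import Mathlib

open MvPolynomial

/-- The complete homogeneous symmetric polynomial of degree `j` in the variables indexed
by the finite set `S`. -/
noncomputable def hset (n : ℕ) (S : Finset (Fin n)) (j : ℕ) : MvPolynomial (Fin n) ℂ :=
  ∑ μ ∈ Finset.univ.filter (fun μ : Sym (Fin n) j => ∀ i ∈ μ, i ∈ S),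
    (μ.val.map MvPolynomial.X).prod

/-- The complete homogeneous symmetric polynomial `h_j(x_1, …, x_k)` of degree `j` in the
first `k` variables (these are the 0-based indices `0, …, k-1`). -/
noncomputable def hfirst (n k j : ℕ) : MvPolynomial (Fin n) ℂ :=
  hset n (Finset.univ.filter (fun i : Fin n => (i : ℕ) < k)) j

/-- The ideal `I_b` generated by `h_{b_1}(x_1), h_{b_2}(x_1,x_2), …, h_{b_n}(x_1,…,x_n)`. -/
noncomputable def Ib {n : ℕ} (b : Fin n → ℕ) : Ideal (MvPolynomial (Fin n) ℂ) :=
  Ideal.span (Set.range fun i : Fin n => hfirst n ((i : ℕ) + 1) (b i))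

theorem hset_zero (n : ℕ) (S : Finset (Fin n)) : hset n S 0 = 1 := by
  simp [hset, Sym.eq_nil_of_card_zero]

theorem hset_empty_succ (n j : ℕ) : hset n ∅ (j + 1) = 0 := by
  rw [hset, Finset.sum_eq_zero]
  intro μ hμ
  obtain ⟨a, ν, rfl⟩ := μ.exists_eq_cons_of_succ
  simpa using (Finset.mem_filter.1 hμ).2 a (Sym.mem_cons_self a ν)

theorem hset_insert_succ {n : ℕ} {S : Finset (Fin n)} {a : Fin n} (ha : a ∉ S) (j : ℕ) :
    hset n (insert a S) (j + 1) = hset n S (j + 1) + X a * hset n (insert a S) j := by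
  simp only [hset]
  rw [← Finset.sum_filter_add_sum_filter_not _ (fun μ : Sym (Fin n) (j + 1) => a ∉ μ)]
  congr 1
  · refine Finset.sum_congr ?_ fun _ _ => rfl
    ext μ
    simp only [Finset.mem_filter, Finset.mem_univ, true_and, Finset.mem_insert]
    constructor
    · rintro ⟨h, hμ⟩ i hi
      exact (h i hi).resolve_left (by rintro rfl; exact hμ hi)
    · intro h
      exact ⟨fun i hi => Or.inr (h i hi), fun hμ => ha (h a hμ)⟩
  · rw [Finset.mul_sum]
    symm
    refine Finset.sum_bij (fun ν _ => a ::ₛ ν) ?_ ?_ ?_ ?_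
    · intro ν hν
      simp only [Finset.mem_filter, Finset.mem_univ, true_and, Finset.mem_insert] at hν ⊢
      simp only [Sym.mem_cons, not_not, true_or, and_true]
      rintro i (rfl | hi)
      · exact Or.inl rfl
      · exact hν i hi
    · intro ν _ ν' _ h
      exact (Sym.cons_inj_right _ _ _).1 h
    · intro μ hμ
      simp only [Finset.mem_filter, Finset.mem_univ, true_and, not_not] at hμ
      obtain ⟨ν, rfl⟩ := Sym.exists_cons_of_mem hμ.2
      refine ⟨ν, ?_, rfl⟩
      simp only [Finset.mem_filter, Finset.mem_univ, true_and]
      exact fun i hi => hμ.1 i (Sym.mem_cons_of_mem hi)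
    · intro ν _
      change _ = ((a ::ₘ ν.val).map X).prod
      simp

theorem hset_univ (n j : ℕ) : hset n Finset.univ j = hsymm (Fin n) ℂ j := by
  simp [hset, hsymm]

theorem constantCoeff_hset_succ (n : ℕ) (S : Finset (Fin n)) (j : ℕ) :
    constantCoeff (hset n S (j + 1)) = 0 := by
  induction S using Finset.induction with
  | empty => simp [hset_empty_succ]
  | insert a S ha ih => simp [hset_insert_succ ha, ih]

theorem hfirst_zero_right (n k : ℕ) : hfirst n k 0 = 1 := hset_zero n _

theorem hfirst_zero_succ (n j : ℕ) : hfirst n 0 (j + 1) = 0 := by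
  simpa [hfirst] using hset_empty_succ n j

theorem hfirst_self (n j : ℕ) : hfirst n n j = hsymm (Fin n) ℂ j := by
  simp [hfirst, hset_univ]

theorem hfirst_succ_succ {n : ℕ} (k : Fin n) (j : ℕ) :
    hfirst n (k + 1) (j + 1) = hfirst n k (j + 1) + X k * hfirst n (k + 1) j := by
  have h : Finset.univ.filter (fun i : Fin n => (i : ℕ) < k + 1) =
      insert k (Finset.univ.filter (fun i : Fin n => (i : ℕ) < k)) := by
    ext i
    simp only [Finset.mem_filter, Finset.mem_univ, true_and, Finset.mem_insert, Fin.ext_iff]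
    omega
  simp only [hfirst, h]
  exact hset_insert_succ (by simp) j

theorem rename_castSucc_hfirst {n k : ℕ} (hk : k ≤ n) (j : ℕ) :
    rename Fin.castSucc (hfirst n k j) = hfirst (n + 1) k j := by
  induction k generalizing j with
  | zero => cases j <;> simp [hfirst_zero_right, hfirst_zero_succ]
  | succ k ihk =>
    induction j with
    | zero => simp [hfirst_zero_right]
    | succ j ihj =>
      have h := hfirst_succ_succ (⟨k, hk⟩ : Fin n) j
      have h' := hfirst_succ_succ (⟨k, by omega⟩ : Fin (n + 1)) j
      simp only at h h'
      rw [h, h', map_add, map_mul, ihj, ihk (by omega), rename_X]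
      rfl

theorem hfirst_succ_self (n m : ℕ) :
    hfirst (n + 1) (n + 1) m = X (Fin.last n) ^ m +
      ∑ j ∈ Finset.range m, rename Fin.castSucc (hfirst n n (m - j)) * X (Fin.last n) ^ j := by
  induction m with
  | zero => simp [hfirst_zero_right]
  | succ m ih =>
    have h := hfirst_succ_succ (Fin.last n) m
    simp only [Fin.val_last] at h
    rw [h, ih, Finset.sum_range_succ', rename_castSucc_hfirst le_rfl, mul_add, Finset.mul_sum]
    simp only [Nat.add_sub_add_right, pow_succ]
    simp only [Nat.sub_zero, pow_zero, mul_one, rename_castSucc_hfirst le_rfl]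
    simp only [mul_left_comm (X (Fin.last n)), mul_comm (X (Fin.last n))]
    ring

/-- The ideal generated by the symmetric polynomials with zero constant term. -/
noncomputable def coinvariantIdeal (n : ℕ) : Ideal (MvPolynomial (Fin n) ℂ) :=
  Ideal.span {p : MvPolynomial (Fin n) ℂ | p.IsSymmetric ∧ constantCoeff p = 0}

theorem hfirst_mem_coinvariantIdeal {n k j : ℕ} (hk : k ≤ n) (hj : n < k + j) :
    hfirst n k j ∈ coinvariantIdeal n := by
  induction hk using Nat.decreasingInduction generalizing j with
  | self =>
    obtain ⟨j, rfl⟩ : ∃ i, j = i + 1 := ⟨j - 1, by omega⟩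
    refine Ideal.subset_span ⟨?_, constantCoeff_hset_succ _ _ _⟩
    rw [hfirst_self]
    exact hsymm_isSymmetric _ _ _
  | of_succ k hk ih =>
    obtain ⟨j, rfl⟩ : ∃ i, j = i + 1 := ⟨j - 1, by omega⟩
    rw [eq_sub_of_add_eq (hfirst_succ_succ (⟨k, hk⟩ : Fin n) j).symm]
    exact sub_mem (ih (by omega)) (Ideal.mul_mem_left _ _ (ih (by omega)))

theorem hfirst_mem_Ib {n k j : ℕ} (hk : k ≤ n) (hj : n < k + j) :
    hfirst n k j ∈ Ib fun i : Fin n => n - (i : ℕ) := by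
  induction k generalizing j with
  | zero =>
    obtain ⟨j, rfl⟩ : ∃ i, j = i + 1 := ⟨j - 1, by omega⟩
    simp [hfirst_zero_succ]
  | succ k ih =>
    obtain ⟨d, rfl⟩ : ∃ d, j = n - k + d := ⟨j - (n - k), by omega⟩
    clear hj
    induction d with
    | zero => exact Ideal.subset_span ⟨⟨k, hk⟩, rfl⟩
    | succ d ihd =>
      rw [← add_assoc, hfirst_succ_succ (⟨k, hk⟩ : Fin n)]
      exact add_mem (ih (by omega) (by omega)) (Ideal.mul_mem_left _ _ ihd)

theorem mk_hset_mul_prod (n : ℕ) (S : Finset (Fin n)) :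
    PowerSeries.mk (hset n S) *
      ∏ i ∈ S, (1 + PowerSeries.C (-X i : MvPolynomial (Fin n) ℂ) * PowerSeries.X) = 1 := by
  induction S using Finset.induction with
  | empty =>
    ext j
    cases j <;> simp [hset_zero, hset_empty_succ, PowerSeries.coeff_one]
  | insert a S ha ih =>
    rw [Finset.prod_insert ha, ← mul_assoc]
    convert ih using 2
    ext1 j
    rw [mul_add, mul_one, mul_left_comm, map_add, PowerSeries.coeff_C_mul]
    cases j with
    | zero => simp [hset_zero]
    | succ j =>
      rw [PowerSeries.coeff_succ_mul_X]
      simp [hset_insert_succ ha]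

theorem coeff_prod_one_add_X {σ : Type*} [Fintype σ] (R : Type*) [CommRing R] (m : ℕ) :
    PowerSeries.coeff m (∏ i : σ, (1 + PowerSeries.C (-X i : MvPolynomial σ R) * PowerSeries.X)) =
      (-1) ^ m * esymm σ R m := by
  rw [Finset.prod_one_add, map_sum]
  have h (t : Finset σ) : PowerSeries.coeff m
      (∏ i ∈ t, (PowerSeries.C (-X i : MvPolynomial σ R) * PowerSeries.X)) =
      if t.card = m then (-1) ^ m * ∏ i ∈ t, X i else 0 := by
    rw [Finset.prod_mul_distrib, ← map_prod, Finset.prod_const, PowerSeries.coeff_C_mul,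
      PowerSeries.coeff_X_pow, Finset.prod_neg]
    aesop
  simp only [h, esymm, Finset.mul_sum]
  rw [← Finset.sum_filter, Finset.powersetCard_eq_filter]

theorem esymm_succ_mem_Ib (n m : ℕ) :
    esymm (Fin n) ℂ (m + 1) ∈ Ib fun i : Fin n => n - (i : ℕ) := by
  set I := Ib fun i : Fin n => n - (i : ℕ)
  have h := congrArg (PowerSeries.map (Ideal.Quotient.mk I)) (mk_hset_mul_prod n Finset.univ)
  have h1 : PowerSeries.map (Ideal.Quotient.mk I) (PowerSeries.mk (hset n Finset.univ)) = 1 := by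
    ext j
    cases j with
    | zero => simp [hset_zero]
    | succ j =>
      have : hfirst n n (j + 1) ∈ I := hfirst_mem_Ib le_rfl (by omega)
      rw [hfirst_self, ← hset_univ] at this
      simpa [PowerSeries.coeff_one] using Ideal.Quotient.eq_zero_iff_mem.2 this
  rw [map_mul, h1, one_mul, map_one] at h
  have h2 := congrArg (PowerSeries.coeff (m + 1)) h
  rw [PowerSeries.coeff_map, coeff_prod_one_add_X, PowerSeries.coeff_one, if_neg (by omega),
    Ideal.Quotient.eq_zero_iff_mem] at h2
  have h3 := I.mul_mem_left ((-1) ^ (m + 1)) h2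
  rwa [← mul_assoc, ← mul_pow, neg_one_mul, neg_neg, one_pow, one_mul] at h3

theorem MvPolynomial.IsSymmetric.mem_Ib {n : ℕ} {p : MvPolynomial (Fin n) ℂ} (hp : p.IsSymmetric)
    (h0 : constantCoeff p = 0) : p ∈ Ib fun i : Fin n => n - (i : ℕ) := by
  set I := Ib fun i : Fin n => n - (i : ℕ)
  obtain ⟨q, hq⟩ := esymmAlgHom_surjective (σ := Fin n) (R := ℂ) (n := n) (by simp) ⟨p, hp⟩
  replace hq : aeval (fun i : Fin n => esymm (Fin n) ℂ (i + 1)) q = p := by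
    rw [← esymmAlgHom_apply, hq]
  have hmk : Ideal.Quotient.mk I p = algebraMap ℂ _ (constantCoeff q) := by
    rw [← hq, ← Ideal.Quotient.mkₐ_eq_mk ℂ, ← AlgHom.comp_apply, comp_aeval]
    have : (fun i : Fin n => Ideal.Quotient.mkₐ ℂ I (esymm (Fin n) ℂ (i + 1))) = fun _ => 0 := by
      funext i
      exact Ideal.Quotient.eq_zero_iff_mem.2 (esymm_succ_mem_Ib n i)
    rw [this]
    exact aeval_zero' q
  have hc : constantCoeff q = 0 := by
    have he (i : ℕ) : constantCoeff (esymm (Fin n) ℂ (i + 1)) = 0 := by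
      rw [esymm, map_sum, Finset.sum_eq_zero]
      intro t ht
      obtain ⟨a, ha⟩ := Finset.card_pos.1 (by rw [(Finset.mem_powersetCard.1 ht).2]; omega)
      rw [map_prod, Finset.prod_eq_zero ha (constantCoeff_X ℂ a)]
    rw [← h0, ← hq, aeval_def, ← coe_eval₂Hom, ← RingHom.comp_apply, comp_eval₂Hom]
    simp [he]
  rwa [hc, map_zero, Ideal.Quotient.eq_zero_iff_mem] at hmk

theorem Ib_eq_coinvariantIdeal (n : ℕ) :
    Ib (fun i : Fin n => n - (i : ℕ)) = coinvariantIdeal n := by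
  refine le_antisymm (Ideal.span_le.2 ?_) (Ideal.span_le.2 ?_)
  · rintro _ ⟨i, rfl⟩
    exact hfirst_mem_coinvariantIdeal i.2 (by simp only; omega)
  · rintro p ⟨hp, h0⟩
    exact hp.mem_Ib h0

/-- The monic polynomial relation `h_m(x_1, …, x_n, T) = 0` satisfied by the last variable, with
coefficients in the quotient of `ℂ[x_1, …, x_n]` by `I`. -/
noncomputable def lastRelation {n : ℕ} (I : Ideal (MvPolynomial (Fin n) ℂ)) (m : ℕ) :
    Polynomial (MvPolynomial (Fin n) ℂ ⧸ I) :=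
  Polynomial.X ^ m + ∑ j ∈ Finset.range m,
    Polynomial.C (Ideal.Quotient.mk I (hfirst n n (m - j))) * Polynomial.X ^ j

theorem degree_lastRelation_tail_lt {n : ℕ} (I : Ideal (MvPolynomial (Fin n) ℂ)) (m : ℕ) :
    Polynomial.degree (∑ j ∈ Finset.range m,
      Polynomial.C (Ideal.Quotient.mk I (hfirst n n (m - j))) * Polynomial.X ^ j) <
        (m : WithBot ℕ) := by
  refine (Polynomial.degree_sum_le _ _).trans_lt ?_
  refine (Finset.sup_lt_iff (WithBot.bot_lt_coe m)).2 fun j hj => ?_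
  exact (Polynomial.degree_C_mul_X_pow_le _ _).trans_lt
    (WithBot.coe_lt_coe.2 (Finset.mem_range.1 hj))

theorem monic_lastRelation {n : ℕ} (I : Ideal (MvPolynomial (Fin n) ℂ)) (m : ℕ) :
    (lastRelation I m).Monic :=
  Polynomial.monic_X_pow_add (degree_lastRelation_tail_lt I m)

theorem natDegree_lastRelation {n : ℕ} (I : Ideal (MvPolynomial (Fin n) ℂ))
    [Nontrivial (MvPolynomial (Fin n) ℂ ⧸ I)] (m : ℕ) : (lastRelation I m).natDegree = m := by
  refine Polynomial.natDegree_eq_of_degree_eq_some ?_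
  rw [lastRelation, Polynomial.degree_add_eq_left_of_degree_lt] <;> rw [Polynomial.degree_X_pow]
  exact degree_lastRelation_tail_lt I m

theorem hfirst_mem_Ib_generator {n : ℕ} (b : Fin n → ℕ) (i : Fin n) :
    hfirst n (i + 1) (b i) ∈ Ib b :=
  Ideal.subset_span ⟨i, rfl⟩

/-- Adding one more variable to `R_b` amounts to adjoining a root of a monic polynomial. -/
theorem nonempty_algEquiv_adjoinRoot {n : ℕ} (b : Fin (n + 1) → ℕ) :
    Nonempty ((MvPolynomial (Fin (n + 1)) ℂ ⧸ Ib b) ≃ₐ[ℂ]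
      AdjoinRoot (lastRelation (Ib fun i => b i.castSucc) (b (Fin.last n)))) := by
  set I := Ib fun i => b i.castSucc
  set f := lastRelation I (b (Fin.last n)) with hf
  let v : Fin (n + 1) → AdjoinRoot f := Fin.lastCases (AdjoinRoot.root f)
    fun i => AdjoinRoot.of f (Ideal.Quotient.mk I (X i))
  have hv_last : v (Fin.last n) = AdjoinRoot.root f := Fin.lastCases_last
  have hv_castSucc (i : Fin n) : v i.castSucc = AdjoinRoot.of f (Ideal.Quotient.mk I (X i)) :=
    Fin.lastCases_castSucc ..
  have hv_rename (p : MvPolynomial (Fin n) ℂ) :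
      aeval v (rename Fin.castSucc p) = AdjoinRoot.of f (Ideal.Quotient.mk I p) := by
    have : (aeval v).comp (rename Fin.castSucc) =
        (AdjoinRoot.ofAlgHom ℂ f).comp (Ideal.Quotient.mkₐ ℂ I) := by
      ext i
      simp [hv_castSucc]
    exact DFunLike.congr_fun this p
  have hker : ∀ p ∈ Ib b, aeval v p = 0 := by
    change Ib b ≤ RingHom.ker (aeval v)
    refine Ideal.span_le.2 ?_
    rintro _ ⟨i, rfl⟩
    change aeval v _ = 0
    induction i using Fin.lastCases with
    | last =>
      simp only [Fin.val_last]
      rw [hfirst_succ_self, map_add, map_sum]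
      simp only [map_mul, map_pow, aeval_X, hv_last, hv_rename]
      have h : Polynomial.eval₂ (AdjoinRoot.of f) (AdjoinRoot.root f) (lastRelation I _) = 0 :=
        AdjoinRoot.eval₂_root f
      simpa only [lastRelation, Polynomial.eval₂_add, Polynomial.eval₂_finsetSum,
        Polynomial.eval₂_mul, Polynomial.eval₂_C, Polynomial.eval₂_X_pow] using h
    | cast i =>
      simp only [Fin.val_castSucc]
      rw [← rename_castSucc_hfirst i.2, hv_rename,
        Ideal.Quotient.eq_zero_iff_mem.2 (hfirst_mem_Ib_generator (fun i => b i.castSucc) i),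
        map_zero]
  have hI_le : ∀ p ∈ I, ((Ideal.Quotient.mkₐ ℂ (Ib b)).comp (rename Fin.castSucc)) p = 0 := by
    change I ≤ RingHom.ker ((Ideal.Quotient.mkₐ ℂ (Ib b)).comp (rename Fin.castSucc))
    refine Ideal.span_le.2 ?_
    rintro _ ⟨i, rfl⟩
    change Ideal.Quotient.mk (Ib b) (rename Fin.castSucc _) = 0
    rw [rename_castSucc_hfirst i.2]
    exact Ideal.Quotient.eq_zero_iff_mem.2 (hfirst_mem_Ib_generator b i.castSucc)
  let ψ : (MvPolynomial (Fin n) ℂ ⧸ I) →ₐ[ℂ] (MvPolynomial (Fin (n + 1)) ℂ ⧸ Ib b) :=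
    Ideal.Quotient.liftₐ I _ hI_le
  have hψ (p : MvPolynomial (Fin n) ℂ) : ψ (Ideal.Quotient.mk I p) =
      Ideal.Quotient.mk (Ib b) (rename Fin.castSucc p) := rfl
  have hroot : f.eval₂ (ψ : _ →+* _) (Ideal.Quotient.mk (Ib b) (X (Fin.last n))) = 0 := by
    have h := Ideal.Quotient.eq_zero_iff_mem.2 (hfirst_mem_Ib_generator b (Fin.last n))
    rw [Fin.val_last, hfirst_succ_self] at h
    simpa [hf, lastRelation, Polynomial.eval₂_finsetSum, hψ] using h
  let φ : (MvPolynomial (Fin (n + 1)) ℂ ⧸ Ib b) →ₐ[ℂ] AdjoinRoot f :=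
    Ideal.Quotient.liftₐ (Ib b) (aeval v) hker
  have hφ (p : MvPolynomial (Fin (n + 1)) ℂ) : φ (Ideal.Quotient.mk (Ib b) p) = aeval v p := rfl
  refine ⟨AlgEquiv.ofAlgHom φ (AdjoinRoot.liftAlgHom f ψ _ hroot) ?_ ?_⟩
  · refine AdjoinRoot.algHom_ext' (Ideal.Quotient.algHom_ext _ (algHom_ext fun i => ?_)) ?_
    · simp [hφ, hψ, hv_castSucc]
    · simp [hφ, hv_last]
  · refine Ideal.Quotient.algHom_ext _ (algHom_ext fun i => ?_)
    induction i using Fin.lastCases with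
    | last => simp [hφ, hv_last]
    | cast i => simp [hφ, hψ, hv_castSucc]

theorem finrank_quotient_Ib {n : ℕ} (b : Fin n → ℕ) (hb : ∀ i, 0 < b i) :
    Module.finrank ℂ (MvPolynomial (Fin n) ℂ ⧸ Ib b) = ∏ i, b i := by
  induction n with
  | zero =>
    have h : Ib b = ⊥ := by simp [Ib]
    rw [h, (AlgEquiv.quotientBot ℂ (MvPolynomial (Fin 0) ℂ)).toLinearEquiv.finrank_eq,
      (isEmptyAlgEquiv ℂ (Fin 0)).toLinearEquiv.finrank_eq]
    simp
  | succ n ih =>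
    obtain ⟨e⟩ := nonempty_algEquiv_adjoinRoot b
    have ih := ih (fun i => b i.castSucc) fun i => hb _
    have : Nontrivial (MvPolynomial (Fin n) ℂ ⧸ Ib fun i => b i.castSucc) :=
      Module.nontrivial_of_finrank_pos (R := ℂ) (by
        rw [ih]
        exact Finset.prod_pos fun i _ => hb _)
    have hmonic := monic_lastRelation (Ib fun i => b i.castSucc) (b (Fin.last n))
    have := hmonic.free_adjoinRoot
    rw [e.toLinearEquiv.finrank_eq, ← Module.finrank_mul_finrank ℂ
      (MvPolynomial (Fin n) ℂ ⧸ Ib fun i => b i.castSucc), ih,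
      (AdjoinRoot.powerBasis' hmonic).finrank, AdjoinRoot.powerBasis'_dim,
      natDegree_lastRelation, Fin.prod_univ_castSucc]

/-- For `b = (n, n−1, …, 1)`, the ideal `I_b` is the ideal generated by all symmetric
polynomials with zero constant term, and `R_b = R/I_b` is the coinvariant algebra,
of dimension `n!` over `ℂ`. -/
theorem stmt4 (n : ℕ) :
    Ib (fun i : Fin n => n - (i : ℕ)) =
      Ideal.span {p : MvPolynomial (Fin n) ℂ | p.IsSymmetric ∧ constantCoeff p = 0} ∧
    Module.finrank ℂ (MvPolynomial (Fin n) ℂ ⧸ Ib (fun i : Fin n => n - (i : ℕ))) =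
      Nat.factorial n := by
  refine ⟨Ib_eq_coinvariantIdeal n, ?_⟩
  rw [finrank_quotient_Ib _ fun i => Nat.sub_pos_of_lt i.2, ← Finset.prod_range (fun i => n - i)]
  exact (Nat.descFactorial_eq_prod_range n n).symm.trans n.descFactorial_self
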